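/- Let Ω ⊂ ℂ^n be a bounded smooth domain, α a smooth Hermitian metric and χ a smooth real (1,1)-form on the closure of Ω with χ ≥ α there, and let B be the matrix field B^i_j = Σ_p α^{p̄ i} χ_{j p̄}. Assume S_m(λ(B)) ≥ f on the closure of Ω, where 0 < f is continuous. If u is C² up to the boundary, admissible, satisfies S_m(λ(A(u))) = f in Ω and u = 0 on ∂Ω, then 0 ≤ u ≤ C₀ on the closure of Ω and |∇u| ≤ C₀′ on ∂Ω, where the constants C₀ and C₀′ depend only on α, χ and Ω (and not on u or f). -/

import Mathlib

open scoped BigOperators ContDiff ComplexOrder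
open Metric

noncomputable section

/-- `ℂ^n` with the Euclidean metric. -/
abbrev Cn (n : ℕ) := EuclideanSpace ℂ (Fin n)

/-- The `k`-th elementary symmetric polynomial `S_k`. -/
def esymm {n : ℕ} (k : ℕ) (lam : Fin n → ℝ) : ℝ :=
  ∑ s ∈ Finset.univ.powersetCard k, ∏ i ∈ s, lam i

/-- The cone `Γ_m = {λ : S_1(λ) > 0, …, S_m(λ) > 0}`. -/
def GammaCone (n m : ℕ) : Set (Fin n → ℝ) :=
  {lam | ∀ k, 1 ≤ k → k ≤ m → 0 < esymm k lam}

/-- `lam` is the tuple of eigenvalues of `a⁻¹ g` (i.e. of `g` with respect to the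
Hermitian metric `a`): the roots of `det (g - t a) = 0`, counted with multiplicity. -/
def IsEigenvalues {n : ℕ} (a g : Matrix (Fin n) (Fin n) ℂ) (lam : Fin n → ℝ) : Prop :=
  ∀ t : ℝ, (g - (t : ℂ) • a).det = a.det * ∏ i, ((lam i : ℂ) - (t : ℂ))

/-- Wirtinger derivative `∂f/∂z_i` relative to a set `s`. -/
def wderOn {n : ℕ} (s : Set (Cn n)) (i : Fin n) (f : Cn n → ℂ) (z : Cn n) : ℂ :=
  (fderivWithin ℝ f s z (EuclideanSpace.single i 1)
    - Complex.I * fderivWithin ℝ f s z (EuclideanSpace.single i Complex.I)) / 2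

/-- Conjugate Wirtinger derivative `∂f/∂z̄_i` relative to a set `s`. -/
def wderBarOn {n : ℕ} (s : Set (Cn n)) (i : Fin n) (f : Cn n → ℂ) (z : Cn n) : ℂ :=
  (fderivWithin ℝ f s z (EuclideanSpace.single i 1)
    + Complex.I * fderivWithin ℝ f s z (EuclideanSpace.single i Complex.I)) / 2

/-- Complex Hessian `∂²u/∂z_i ∂z̄_j` of a real-valued function, relative to a set `s`. -/
def cHessOn {n : ℕ} (s : Set (Cn n)) (u : Cn n → ℝ) (i j : Fin n) (z : Cn n) : ℂ :=
  wderOn s i (wderBarOn s j fun w => (u w : ℂ)) z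

/-- The matrix `g_{i j̄} = χ_{i j̄} + ∂²u/∂z_i ∂z̄_j`. -/
def gMatOn {n : ℕ} (s : Set (Cn n)) (χ : Cn n → Matrix (Fin n) (Fin n) ℂ) (u : Cn n → ℝ)
    (z : Cn n) : Matrix (Fin n) (Fin n) ℂ :=
  Matrix.of fun i j => χ z i j + cHessOn s u i j z

/-- `α` is a smooth Hermitian metric on `S`. -/
def IsHermitianMetricOn {n : ℕ} (α : Cn n → Matrix (Fin n) (Fin n) ℂ) (S : Set (Cn n)) : Prop :=
  (∀ i j, ContDiffOn ℝ ∞ (fun z => α z i j) S) ∧ ∀ z ∈ S, (α z).PosDef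

/-- `χ` is a smooth real `(1,1)`-form on `S`. -/
def IsRealFormOn {n : ℕ} (χ : Cn n → Matrix (Fin n) (Fin n) ℂ) (S : Set (Cn n)) : Prop :=
  (∀ i j, ContDiffOn ℝ ∞ (fun z => χ z i j) S) ∧ ∀ z ∈ S, (χ z).IsHermitian

/-- `u` is admissible and solves `S_m(λ(A(u))) = f` on `S`; derivatives are taken
relative to the set `s`. -/
def IsAdmissibleSolutionOn {n : ℕ} (m : ℕ) (α χ : Cn n → Matrix (Fin n) (Fin n) ℂ)
    (s : Set (Cn n)) (u f : Cn n → ℝ) (S : Set (Cn n)) : Prop :=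
  ∀ z ∈ S, ∃ lam : Fin n → ℝ, IsEigenvalues (α z) (gMatOn s χ u z) lam ∧
    lam ∈ GammaCone n m ∧ esymm m lam = f z


/-- A bounded smooth domain in `ℂ^n`, presented by a global smooth defining function. -/
def IsSmoothDomain {n : ℕ} (Ω : Set (Cn n)) : Prop :=
  IsOpen Ω ∧ Bornology.IsBounded Ω ∧
    ∃ ρ : Cn n → ℝ, ContDiff ℝ ∞ ρ ∧ Ω = {z | ρ z < 0} ∧
      ∀ z ∈ frontier Ω, ρ z = 0 ∧ fderiv ℝ ρ z ≠ 0

section LinearAlgebra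

open Matrix Polynomial

lemma exists_conjTranspose_mul_mul_eq_one {n : Type*} [Fintype n] [DecidableEq n]
    {a : Matrix n n ℂ} (ha : a.PosDef) :
    ∃ Q : Matrix n n ℂ, IsUnit Q ∧ Qᴴ * a * Q = 1 ∧ Q * Qᴴ = a⁻¹ := by
  obtain ⟨B, hB⟩ : ∃ B : Matrix n n ℂ, a = Bᴴ * B := by
    open scoped MatrixOrder in
    exact CStarAlgebra.nonneg_iff_eq_star_mul_self.mp ha.posSemidef.nonneg
  have hBu : IsUnit B := by
    have h := ha.isUnit
    rw [hB, Matrix.isUnit_iff_isUnit_det, det_mul] at h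
    rw [Matrix.isUnit_iff_isUnit_det]
    exact isUnit_of_mul_isUnit_right h
  have hdet : IsUnit B.det := (Matrix.isUnit_iff_isUnit_det _).1 hBu
  refine ⟨B⁻¹, (Matrix.isUnit_nonsing_inv_iff).2 hBu, ?_, ?_⟩
  · have : (B⁻¹)ᴴ * Bᴴ = 1 := by
      rw [← conjTranspose_mul, Matrix.mul_nonsing_inv _ hdet, conjTranspose_one]
    rw [hB, ← Matrix.mul_assoc, this, Matrix.one_mul, Matrix.mul_nonsing_inv _ hdet]
  · rw [hB, Matrix.mul_inv_rev, conjTranspose_nonsing_inv]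

lemma one_lt_det_one_add {n : Type*} [Fintype n] [DecidableEq n] [Nonempty n]
    {K : Matrix n n ℂ} (hK : K.PosDef) : 1 < (1 + K).det := by
  have h1 : (1 + K).det = ∏ i, ((1 + hK.1.eigenvalues i : ℝ) : ℂ) := by
    have h2 : (1 + K).det = (-1) ^ Fintype.card n * K.charpoly.eval (-1) := by
      rw [Matrix.eval_charpoly, ← det_neg]
      congr 1
      simp [Matrix.scalar_apply, ← Matrix.diagonal_neg, add_comm]
    rw [h2, hK.1.charpoly_eq, eval_prod, ← Finset.card_univ, ← Finset.prod_const,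
      ← Finset.prod_mul_distrib]
    refine Finset.prod_congr rfl fun i _ => ?_
    simp
    ring
  rw [h1, ← Complex.ofReal_prod]
  have : (1 : ℝ) < ∏ i, (1 + hK.1.eigenvalues i) := by
    have := Finset.prod_lt_prod_of_nonempty (s := Finset.univ) (f := fun _ : n => (1 : ℝ))
      (g := fun i => 1 + hK.1.eigenvalues i) (fun i _ => one_pos)
      (fun i _ => by linarith [hK.eigenvalues_pos i]) Finset.univ_nonempty
    simpa using this
  exact_mod_cast this

lemma det_lt_det_add {n : Type*} [Fintype n] [DecidableEq n] [Nonempty n]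
    {G H : Matrix n n ℂ} (hG : G.PosDef) (hH : H.PosDef) : G.det < (G + H).det := by
  obtain ⟨Q, hQ, hQ1, -⟩ := exists_conjTranspose_mul_mul_eq_one hG
  have hK : (Qᴴ * H * Q).PosDef := hH.conjTranspose_mul_mul_same
    (Matrix.mulVec_injective_of_isUnit hQ)
  have h1 := one_lt_det_one_add hK
  have h2 : (1 + Qᴴ * H * Q).det * G.det = (G + H).det := by
    have h3 : 1 + Qᴴ * H * Q = Qᴴ * (G + H) * Q := by
      rw [← hQ1]; noncomm_ring
    have h4 : (Qᴴ).det * G.det * Q.det = 1 := by rw [← det_mul, ← det_mul, hQ1, det_one]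
    rw [h3, det_mul, det_mul]
    linear_combination (G + H).det * h4
  rw [← h2]
  exact lt_mul_of_one_lt_left hG.det_pos h1

/-- After normalising the metric, elementary symmetric functions of the eigenvalues are sums of
principal minors. -/
lemma IsEigenvalues.esymm_eq_sum_minors {n : ℕ} {a g Q : Matrix (Fin n) (Fin n) ℂ}
    {lam : Fin n → ℝ} (h : IsEigenvalues a g lam) (hQ : Qᴴ * a * Q = 1) (k : ℕ) :
    ((esymm k lam : ℝ) : ℂ) = ∑ s ∈ Finset.univ.powersetCard k,
      ((Qᴴ * g * Q).submatrix (Subtype.val : s → Fin n) (Subtype.val : s → Fin n)).det := by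
  set G := Qᴴ * g * Q with hG
  have hdet : (Qᴴ).det * a.det * Q.det = 1 := by rw [← det_mul, ← det_mul, hQ, det_one]
  have hGt : ∀ t : ℝ, (G - (t : ℂ) • (1 : Matrix (Fin n) (Fin n) ℂ)).det
      = ∏ i, ((lam i : ℂ) - (t : ℂ)) := by
    intro t
    have h3 : G - (t : ℂ) • (1 : Matrix (Fin n) (Fin n) ℂ) = Qᴴ * (g - (t : ℂ) • a) * Q := by
      rw [hG, ← hQ]
      simp [Matrix.mul_sub, Matrix.sub_mul]
    rw [h3, det_mul, det_mul, h t]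
    linear_combination (∏ i, ((lam i : ℂ) - (t : ℂ))) * hdet
  have hpoly : det (1 + (X : ℂ[X]) • G.map C) = ∏ i, (1 + X * C (lam i : ℂ)) := by
    refine Polynomial.eq_of_infinite_eval_eq _ _ ?_
    have hinf : (((↑) : ℝ → ℂ) '' Set.Ioi 0).Infinite :=
      (Set.Ioi_infinite 0).image Complex.ofReal_injective.injOn
    refine hinf.mono ?_
    rintro _ ⟨s, hs, rfl⟩
    have hs0 : (s : ℂ) ≠ 0 := by exact_mod_cast (ne_of_gt hs)
    have e1 : (det (1 + (X : ℂ[X]) • G.map C)).eval (s : ℂ) = (1 + (s : ℂ) • G).det := by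
      rw [← Polynomial.coe_evalRingHom, RingHom.map_det]
      congr 1
      ext i j
      simp [Matrix.one_apply, apply_ite]
      ring
    have e2 : (1 + (s : ℂ) • G)
        = (s : ℂ) • (G - ((-(s⁻¹) : ℝ) : ℂ) • (1 : Matrix (Fin n) (Fin n) ℂ)) := by
      rw [smul_sub, smul_smul]
      push_cast
      rw [mul_neg, mul_inv_cancel₀ hs0]
      simp [add_comm]
    show _ = _
    rw [e1, e2, det_smul, hGt, eval_prod, ← Finset.card_univ, ← Finset.prod_const,
      ← Finset.prod_mul_distrib]
    refine Finset.prod_congr rfl fun i _ => ?_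
    simp
    field_simp
    ring
  rw [← coeff_det_one_add_X_smul_eq_sum_minors, hpoly, Finset.prod_one_add]
  simp only [Finset.prod_mul_distrib, Finset.prod_const, ← map_prod, finsetSum_coeff]
  simp only [mul_comm (X ^ _) (C _), C_mul_X_pow_eq_monomial, coeff_monomial]
  rw [← Finset.sum_filter, esymm]
  push_cast
  refine Finset.sum_congr ?_ fun _ _ => rfl
  ext s
  simp [Finset.mem_powersetCard]

lemma IsEigenvalues.esymm_one {n : ℕ} {a g : Matrix (Fin n) (Fin n) ℂ}
    {lam : Fin n → ℝ} (h : IsEigenvalues a g lam) (ha : a.PosDef) :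
    ((esymm 1 lam : ℝ) : ℂ) = (a⁻¹ * g).trace := by
  obtain ⟨Q, -, hQ1, hQ2⟩ := exists_conjTranspose_mul_mul_eq_one ha
  have htr : (a⁻¹ * g).trace = (Qᴴ * g * Q).trace := by
    rw [← hQ2, Matrix.mul_assoc, Matrix.trace_mul_comm]
  rw [h.esymm_eq_sum_minors hQ1, Finset.powersetCard_one, Finset.sum_map, htr, Matrix.trace]
  refine Finset.sum_congr rfl fun i _ => ?_
  show Matrix.det (n := ({i} : Finset (Fin n))) _ = _
  rw [Matrix.det_unique]
  simp

/-- Strict monotonicity of `S_m` of the eigenvalues on positive definite matrices. -/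
lemma IsEigenvalues.esymm_lt {n m : ℕ} (hm : 1 ≤ m) (hmn : m ≤ n)
    {a g h : Matrix (Fin n) (Fin n) ℂ} {lam mu : Fin n → ℝ} (ha : a.PosDef) (hg : g.PosDef)
    (hh : h.PosDef) (hlam : IsEigenvalues a g lam) (hmu : IsEigenvalues a (g + h) mu) :
    esymm m lam < esymm m mu := by
  obtain ⟨Q, hQ, hQ1, -⟩ := exists_conjTranspose_mul_mul_eq_one ha
  have hinj := Matrix.mulVec_injective_of_isUnit hQ
  suffices ((esymm m lam : ℝ) : ℂ) < ((esymm m mu : ℝ) : ℂ) by exact_mod_cast this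
  rw [hlam.esymm_eq_sum_minors hQ1, hmu.esymm_eq_sum_minors hQ1]
  refine Finset.sum_lt_sum_of_nonempty ?_ fun s hs => ?_
  · exact Finset.powersetCard_nonempty.2 (by simpa using hmn)
  · have hne : Nonempty s := by
      have := (Finset.mem_powersetCard.1 hs).2
      exact (Finset.card_pos.1 (by omega)).to_subtype
    rw [Matrix.mul_add, Matrix.add_mul, Matrix.submatrix_add]
    exact det_lt_det_add ((hg.conjTranspose_mul_mul_same hinj).submatrix Subtype.val_injective)
      ((hh.conjTranspose_mul_mul_same hinj).submatrix Subtype.val_injective)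

lemma trace_mul_nonneg {n : Type*} [Fintype n] [DecidableEq n] {A B : Matrix n n ℂ}
    (hA : A.PosDef) (hB : B.PosSemidef) : 0 ≤ (A⁻¹ * B).trace := by
  obtain ⟨Q, -, -, hQ⟩ := exists_conjTranspose_mul_mul_eq_one hA
  rw [← hQ, Matrix.mul_assoc, Matrix.trace_mul_comm]
  exact (hB.conjTranspose_mul_mul_same Q).trace_nonneg

end LinearAlgebra

section ComplexHessian

open Matrix Topology Filter

/-- The complex Hessian of `u` as a matrix. -/
def cHessMat {n : ℕ} (s : Set (Cn n)) (u : Cn n → ℝ) (z : Cn n) : Matrix (Fin n) (Fin n) ℂ :=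
  Matrix.of fun i j => cHessOn s u i j z

lemma gMatOn_eq_add {n : ℕ} (s : Set (Cn n)) (χ : Cn n → Matrix (Fin n) (Fin n) ℂ)
    (u : Cn n → ℝ) (z : Cn n) : gMatOn s χ u z = χ z + cHessMat s u z := rfl

lemma hasFDerivAt_fderiv_apply {E : Type*} [NormedAddCommGroup E] [NormedSpace ℝ E]
    {u : E → ℝ} {z : E} (hu : ContDiffAt ℝ 2 u z) (v : E) :
    HasFDerivAt (fun w => fderiv ℝ u w v) ((fderiv ℝ (fderiv ℝ u) z).flip v) z := by
  have h : DifferentiableAt ℝ (fderiv ℝ u) z :=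
    (hu.fderiv_right (m := 1) le_rfl).differentiableAt one_ne_zero
  have := h.hasFDerivAt.clm_apply (hasFDerivAt_const v z)
  simpa using this

lemma cHessOn_eq {n : ℕ} {s : Set (Cn n)} {u : Cn n → ℝ} {z : Cn n} (hs : s ∈ 𝓝 z)
    (hu : ContDiffAt ℝ 2 u z) (i j : Fin n) :
    cHessOn s u i j z =
      ((((fderiv ℝ (fderiv ℝ u) z (EuclideanSpace.single i 1) (EuclideanSpace.single j 1)
        + fderiv ℝ (fderiv ℝ u) z (EuclideanSpace.single i Complex.I)
            (EuclideanSpace.single j Complex.I) : ℝ) : ℂ)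
      + Complex.I * ((fderiv ℝ (fderiv ℝ u) z (EuclideanSpace.single i 1)
            (EuclideanSpace.single j Complex.I)
        - fderiv ℝ (fderiv ℝ u) z (EuclideanSpace.single i Complex.I)
            (EuclideanSpace.single j 1) : ℝ) : ℂ)) / 4) := by
  have hev : wderBarOn s j (fun w => (u w : ℂ)) =ᶠ[𝓝 z] fun w =>
      (((fderiv ℝ u w (EuclideanSpace.single j 1) : ℝ) : ℂ)
        + Complex.I * ((fderiv ℝ u w (EuclideanSpace.single j Complex.I) : ℝ) : ℂ)) / 2 := by
    filter_upwards [eventually_mem_nhds_iff.2 hs, hu.eventually (by simp)] with w hw huw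
    have h1 : HasFDerivAt (fun w => (u w : ℂ)) (Complex.ofRealCLM.comp (fderiv ℝ u w)) w :=
      Complex.ofRealCLM.hasFDerivAt.comp w (huw.differentiableAt two_ne_zero).hasFDerivAt
    rw [wderBarOn, fderivWithin_of_mem_nhds hw, h1.fderiv]
    simp
  have hder : HasFDerivAt (wderBarOn s j (fun w => (u w : ℂ))) _ z :=
    (((Complex.ofRealCLM.hasFDerivAt.comp z
        (hasFDerivAt_fderiv_apply hu (EuclideanSpace.single j 1))).add
      ((Complex.ofRealCLM.hasFDerivAt.comp z
        (hasFDerivAt_fderiv_apply hu (EuclideanSpace.single j Complex.I))).const_mul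
          Complex.I)).mul_const ((2 : ℂ)⁻¹)).congr_of_eventuallyEq
    (hev.trans (Eventually.of_forall fun w => by simp [div_eq_mul_inv]))
  rw [cHessOn, wderOn, fderivWithin_of_mem_nhds hs, hder.fderiv]
  simp
  ring_nf
  simp
  ring

lemma cHessMat_isHermitian {n : ℕ} {s : Set (Cn n)} {u : Cn n → ℝ} {z : Cn n} (hs : s ∈ 𝓝 z)
    (hu : ContDiffAt ℝ 2 u z) : (cHessMat s u z).IsHermitian := by
  have hsym := hu.isSymmSndFDerivAt (by simp)
  ext i j
  rw [conjTranspose_apply]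
  simp only [cHessMat, Matrix.of_apply, cHessOn_eq hs hu]
  rw [hsym.eq (EuclideanSpace.single j 1) (EuclideanSpace.single i 1),
    hsym.eq (EuclideanSpace.single j Complex.I) (EuclideanSpace.single i Complex.I),
    hsym.eq (EuclideanSpace.single j 1) (EuclideanSpace.single i Complex.I),
    hsym.eq (EuclideanSpace.single j Complex.I) (EuclideanSpace.single i 1)]
  apply Complex.ext <;> simp

lemma single_eq_re_add_im {n : ℕ} (i : Fin n) (c : ℂ) :
    (EuclideanSpace.single i c : Cn n) =
      c.re • EuclideanSpace.single i (1 : ℂ) + c.im • EuclideanSpace.single i Complex.I := by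
  ext k
  by_cases h : k = i
  · subst h
    apply Complex.ext <;> simp
  · simp [h]

lemma eq_sum_single {n : ℕ} (ξ : Cn n) : ξ = ∑ i, EuclideanSpace.single i (ξ i) := by
  ext k
  simp [Finset.sum_apply]

/-- The Levi form of `u` in terms of the real Hessian. -/
lemma re_form_cHessMat {n : ℕ} {s : Set (Cn n)} {u : Cn n → ℝ} {z : Cn n} (hs : s ∈ 𝓝 z)
    (hu : ContDiffAt ℝ 2 u z) (ξ : Cn n) :
    (ξ ⬝ᵥ (cHessMat s u z *ᵥ (star ξ.ofLp))).re =
      (fderiv ℝ (fderiv ℝ u) z ξ ξ +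
        fderiv ℝ (fderiv ℝ u) z (Complex.I • ξ) (Complex.I • ξ)) / 4 := by
  have key : ∀ η : Cn n, fderiv ℝ (fderiv ℝ u) z η η = ∑ i, ∑ j,
      fderiv ℝ (fderiv ℝ u) z (EuclideanSpace.single i (η i)) (EuclideanSpace.single j (η j)) := by
    intro η
    conv_lhs => rw [eq_sum_single η]
    simp only [map_sum, _root_.sum_apply]
    rw [Finset.sum_comm]
  rw [key ξ, key (Complex.I • ξ), ← Finset.sum_add_distrib, Finset.sum_div]
  simp only [dotProduct, mulVec, Complex.re_sum, Finset.mul_sum]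
  refine Finset.sum_congr rfl fun i _ => ?_
  rw [← Finset.sum_add_distrib, Finset.sum_div]
  refine Finset.sum_congr rfl fun j _ => ?_
  rw [single_eq_re_add_im i (ξ i), single_eq_re_add_im j (ξ j),
    single_eq_re_add_im i ((Complex.I • ξ) i), single_eq_re_add_im j ((Complex.I • ξ) j)]
  simp only [cHessMat, Matrix.of_apply, cHessOn_eq hs hu]
  simp
  ring

/-- At a local maximum the second derivative is nonpositive. -/
lemma snd_deriv_nonpos_of_isLocalMax {F F' : ℝ → ℝ} {c : ℝ}
    (hF : ∀ᶠ t in 𝓝 0, HasDerivAt F (F' t) t) (hF' : HasDerivAt F' c 0) (hmax : IsLocalMax F 0) :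
    c ≤ 0 := by
  by_contra! hc
  have hd : deriv F =ᶠ[𝓝 0] F' := hF.mono fun t ht => ht.deriv
  have hdd : deriv (deriv F) 0 = c := by rw [hd.deriv_eq, hF'.deriv]
  have hmin : IsLocalMin F 0 := isLocalMin_of_deriv_deriv_pos (by rw [hdd]; exact hc)
    hmax.deriv_eq_zero hF.self_of_nhds.continuousAt
  have hconst : F =ᶠ[𝓝 0] fun _ => F 0 := by
    filter_upwards [hmin, hmax] with t h1 h2 using le_antisymm h2 h1
  have h0 : deriv (deriv F) 0 = 0 := by
    rw [hconst.deriv.deriv_eq]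
    simp
  linarith

lemma hasDerivAt_line {E : Type*} [NormedAddCommGroup E] [NormedSpace ℝ E] {u : E → ℝ} {z : E}
    (hu : ContDiffAt ℝ 2 u z) (ξ : E) :
    (∀ᶠ t in 𝓝 (0 : ℝ), HasDerivAt (fun t : ℝ => u (z + t • ξ)) (fderiv ℝ u (z + t • ξ) ξ) t) ∧
      HasDerivAt (fun t : ℝ => fderiv ℝ u (z + t • ξ) ξ) (fderiv ℝ (fderiv ℝ u) z ξ ξ) 0 := by
  have hline : ∀ t : ℝ, HasDerivAt (fun t : ℝ => z + t • ξ) ξ t := fun t => by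
    simpa using ((hasDerivAt_id t).smul_const ξ).const_add z
  have hcont : Tendsto (fun t : ℝ => z + t • ξ) (𝓝 0) (𝓝 z) := by
    simpa using (hline 0).continuousAt.tendsto
  constructor
  · filter_upwards [hcont.eventually (hu.eventually (by simp))] with t ht
    exact (ht.differentiableAt two_ne_zero).hasFDerivAt.comp_hasDerivAt t (hline t)
  · have h := hasFDerivAt_fderiv_apply hu ξ
    rw [show z = z + (0 : ℝ) • ξ by simp] at h
    have h3 := h.comp_hasDerivAt (0 : ℝ) (hline 0)
    simpa [Function.comp_def] using h3

/-- If `u - w` has a local maximum at `z`, the second derivative of `u` along a line is at most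
that of `w`. -/
lemma snd_fderiv_le_of_isLocalMax_sub {E : Type*} [NormedAddCommGroup E] [NormedSpace ℝ E]
    {u w : E → ℝ} {z : E} (hu : ContDiffAt ℝ 2 u z) (hmax : IsLocalMax (fun x => u x - w x) z)
    {ξ : E} {h' : ℝ → ℝ} {c : ℝ}
    (hw : ∀ t : ℝ, HasDerivAt (fun t : ℝ => w (z + t • ξ)) (h' t) t) (hw' : HasDerivAt h' c 0) :
    fderiv ℝ (fderiv ℝ u) z ξ ξ ≤ c := by
  obtain ⟨h1, h2⟩ := hasDerivAt_line hu ξ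
  have hcont : Tendsto (fun t : ℝ => z + t • ξ) (𝓝 0) (𝓝 z) := by
    have : Continuous fun t : ℝ => z + t • ξ := by fun_prop
    simpa using this.tendsto 0
  have hm : IsLocalMax (fun t : ℝ => u (z + t • ξ) - w (z + t • ξ)) 0 := by
    filter_upwards [hcont.eventually hmax] with t ht
    simpa using ht
  have := snd_deriv_nonpos_of_isLocalMax (h1.mono fun t ht => ht.sub (hw t)) (h2.sub hw') hm
  linarith

lemma snd_fderiv_ge_of_isLocalMin_sub {E : Type*} [NormedAddCommGroup E] [NormedSpace ℝ E]
    {u w : E → ℝ} {z : E} (hu : ContDiffAt ℝ 2 u z) (hmin : IsLocalMin (fun x => u x - w x) z)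
    {ξ : E} {h' : ℝ → ℝ} {c : ℝ}
    (hw : ∀ t : ℝ, HasDerivAt (fun t : ℝ => w (z + t • ξ)) (h' t) t) (hw' : HasDerivAt h' c 0) :
    c ≤ fderiv ℝ (fderiv ℝ u) z ξ ξ := by
  have h := snd_fderiv_le_of_isLocalMax_sub (u := fun x => -u x) (w := fun x => -w x) hu.neg
    (by filter_upwards [hmin] with t ht; simp at ht ⊢; linarith) (fun t => (hw t).neg) hw'.neg
  have e : fderiv ℝ (fun x => -u x) = fun x => -fderiv ℝ u x := by
    ext1 x; exact fderiv_fun_neg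
  rw [e, fderiv_fun_neg] at h
  simpa using h

end ComplexHessian

section Barrier

open Matrix Topology Filter

lemma Matrix.IsHermitian.ofReal_smul {n : Type*} {A : Matrix n n ℂ} (hA : A.IsHermitian) (c : ℝ) :
    ((c : ℂ) • A).IsHermitian := by
  rw [IsHermitian, conjTranspose_smul, hA.eq]
  simp

lemma norm_add_real_smul_sq {n : ℕ} (ζ ξ : Cn n) (t : ℝ) :
    ‖ζ + t • ξ‖ ^ 2 = ‖ζ‖ ^ 2 + 2 * (inner ℂ ζ ξ).re * t + ‖ξ‖ ^ 2 * t ^ 2 := by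
  rw [norm_add_sq (𝕜 := ℂ), ← Complex.coe_smul, inner_smul_right, norm_smul]
  simp [mul_pow]
  ring

lemma re_inner_sq_add_re_inner_I_smul_sq {n : ℕ} (ζ ξ : Cn n) :
    (inner ℂ ζ ξ).re ^ 2 + (inner ℂ ζ (Complex.I • ξ)).re ^ 2 = Complex.normSq (inner ℂ ζ ξ) := by
  rw [inner_smul_right, Complex.normSq_apply]
  simp
  ring

lemma dotProduct_star_self {n : ℕ} (ξ : Cn n) : ξ.ofLp ⬝ᵥ star ξ.ofLp = ((‖ξ‖ ^ 2 : ℝ) : ℂ) := by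
  have h := inner_self_eq_norm_sq_to_K (𝕜 := ℂ) ξ
  rw [EuclideanSpace.inner_eq_star_dotProduct] at h
  rw [h]
  norm_cast

lemma hasDerivAt_quadratic (a b c t : ℝ) :
    HasDerivAt (fun t : ℝ => a + 2 * b * t + c * t ^ 2) (2 * b + 2 * c * t) t := by
  have h := (((hasDerivAt_id t).const_mul (2 * b)).const_add a).add
    (((hasDerivAt_id t).pow 2).const_mul c)
  refine (h.congr_deriv ?_)
  simp
  ring

lemma hasDerivAt_barrier (K A q a b c t : ℝ) :
    HasDerivAt (fun t : ℝ => K * (A - Real.exp (-q * (a + 2 * b * t + c * t ^ 2))))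
      (K * q * ((2 * b + 2 * c * t) * Real.exp (-q * (a + 2 * b * t + c * t ^ 2)))) t := by
  have h := (((hasDerivAt_quadratic a b c t).const_mul (-q)).exp.const_sub A).const_mul K
  refine h.congr_deriv ?_
  ring

lemma hasDerivAt_deriv_barrier (K q a b c : ℝ) :
    HasDerivAt (fun t : ℝ =>
      K * q * ((2 * b + 2 * c * t) * Real.exp (-q * (a + 2 * b * t + c * t ^ 2))))
      (K * q * Real.exp (-q * a) * (2 * c - 4 * q * b ^ 2)) 0 := by
  have h1 : HasDerivAt (fun t : ℝ => 2 * b + 2 * c * t) (2 * c) 0 := by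
    simpa using ((hasDerivAt_id (0 : ℝ)).const_mul (2 * c)).const_add (2 * b)
  have h := (h1.mul ((hasDerivAt_quadratic a b c 0).const_mul (-q)).exp).const_mul (K * q)
  refine h.congr_deriv ?_
  simp
  ring

/-- The function `z ↦ K (exp (-q r²) - exp (-q |z - y|²))`. -/
def barrier {n : ℕ} (K q r : ℝ) (y z : Cn n) : ℝ :=
  K * (Real.exp (-q * r ^ 2) - Real.exp (-q * ‖z - y‖ ^ 2))

lemma continuous_barrier {n : ℕ} (K q r : ℝ) (y : Cn n) : Continuous (barrier K q r y) := by
  unfold barrier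
  fun_prop

lemma posSemidef_of_re_nonneg {n : ℕ} {A : Matrix (Fin n) (Fin n) ℂ} (hA : A.IsHermitian)
    (h : ∀ ξ : Cn n, 0 ≤ (ξ.ofLp ⬝ᵥ (A *ᵥ star ξ.ofLp)).re) : A.PosSemidef := by
  refine PosSemidef.of_dotProduct_mulVec_nonneg hA fun x => ?_
  rw [Complex.nonneg_iff]
  refine ⟨?_, (hA.im_star_dotProduct_mulVec_self x).symm⟩
  simpa using h (WithLp.toLp 2 (star x))

/-- Upper bound for the complex Hessian of `u` at a maximum of `u - barrier`. -/
lemma posSemidef_sub_cHessMat {n : ℕ} {s : Set (Cn n)} {u : Cn n → ℝ} {z y : Cn n} (hs : s ∈ 𝓝 z)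
    (hu : ContDiffAt ℝ 2 u z) {K q r : ℝ}
    (hmax : IsLocalMax (fun x => u x - barrier K q r y x) z) :
    (((K * q * Real.exp (-q * ‖z - y‖ ^ 2) : ℝ) : ℂ) •
      ((1 : Matrix (Fin n) (Fin n) ℂ) -
        (q : ℂ) • vecMulVec (star (z - y).ofLp) (z - y).ofLp) - cHessMat s u z).PosSemidef := by
  set ζ := z - y with hζ
  have hline : ∀ ξ : Cn n, fderiv ℝ (fderiv ℝ u) z ξ ξ ≤
      K * q * Real.exp (-q * ‖ζ‖ ^ 2) * (2 * ‖ξ‖ ^ 2 - 4 * q * (inner ℂ ζ ξ).re ^ 2) := by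
    intro ξ
    refine snd_fderiv_le_of_isLocalMax_sub hu hmax (fun t => ?_)
      (hasDerivAt_deriv_barrier K q (‖ζ‖ ^ 2) (inner ℂ ζ ξ).re (‖ξ‖ ^ 2))
    refine (hasDerivAt_barrier K (Real.exp (-q * r ^ 2)) q _ _ _ t).congr_of_eventuallyEq
      (Eventually.of_forall fun t => ?_)
    have e : z + t • ξ - y = ζ + t • ξ := by rw [hζ]; abel
    simp only [barrier, e, norm_add_real_smul_sq]
  refine posSemidef_of_re_nonneg ?_ fun ξ => ?_
  · refine IsHermitian.sub ?_ (cHessMat_isHermitian hs hu)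
    refine (isHermitian_one.sub (IsHermitian.ofReal_smul ?_ q)).ofReal_smul _
    ext i j
    simp [vecMulVec_apply, mul_comm]
  · rw [Matrix.sub_mulVec, dotProduct_sub, Complex.sub_re, re_form_cHessMat hs hu]
    have h1 := hline ξ
    have h2 := hline (Complex.I • ξ)
    have h3 := re_inner_sq_add_re_inner_I_smul_sq ζ ξ
    have h4 : ‖Complex.I • ξ‖ = ‖ξ‖ := by simp [norm_smul]
    have h5 : (ξ.ofLp ⬝ᵥ ((((K * q * Real.exp (-q * ‖ζ‖ ^ 2) : ℝ) : ℂ) •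
        ((1 : Matrix (Fin n) (Fin n) ℂ) -
        (q : ℂ) • vecMulVec (star ζ.ofLp) ζ.ofLp)) *ᵥ star ξ.ofLp)).re =
        K * q * Real.exp (-q * ‖ζ‖ ^ 2) * (‖ξ‖ ^ 2 - q * Complex.normSq (inner ℂ ζ ξ)) := by
      have e1 : (ξ.ofLp ⬝ᵥ star ζ.ofLp) = inner ℂ ζ ξ := by
        rw [EuclideanSpace.inner_eq_star_dotProduct]
      have e2 : (ζ.ofLp ⬝ᵥ star ξ.ofLp) = (starRingEnd ℂ) (inner ℂ ζ ξ) := by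
        rw [inner_conj_symm, EuclideanSpace.inner_eq_star_dotProduct]
      rw [Matrix.smul_mulVec, Matrix.sub_mulVec, Matrix.one_mulVec, Matrix.smul_mulVec,
        Matrix.vecMulVec_mulVec, dotProduct_smul, dotProduct_sub, dotProduct_smul,
        dotProduct_star_self, e2, op_smul_eq_smul, dotProduct_smul, e1]
      rw [smul_eq_mul, Complex.re_ofReal_mul, Complex.sub_re, smul_eq_mul, Complex.re_ofReal_mul,
        smul_eq_mul, mul_comm ((starRingEnd ℂ) _), Complex.mul_conj, Complex.ofReal_re,
        Complex.ofReal_re]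
    rw [h5, ← h3]
    rw [h4] at h2
    nlinarith [h1, h2]

lemma re_trace_inv_mul_barrier {n : ℕ} (a : Matrix (Fin n) (Fin n) ℂ) (e q : ℝ) (ζ : Cn n) :
    (a⁻¹ * ((e : ℂ) • ((1 : Matrix (Fin n) (Fin n) ℂ) -
        (q : ℂ) • vecMulVec (star ζ.ofLp) ζ.ofLp))).trace.re =
      e * (a⁻¹.trace.re - q * (ζ.ofLp ⬝ᵥ (a⁻¹ *ᵥ star ζ.ofLp)).re) := by
  rw [Matrix.mul_smul, Matrix.mul_sub, Matrix.mul_one, Matrix.mul_smul, Matrix.mul_vecMulVec,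
    trace_smul, trace_sub, trace_smul, trace_vecMulVec, dotProduct_comm]
  simp

/-- Barriers dominate admissible solutions. -/
lemma le_barrier {n m : ℕ} (hm : 1 ≤ m) {Ω : Set (Cn n)} (hΩo : IsOpen Ω)
    (hΩb : Bornology.IsBounded Ω) {α χ : Cn n → Matrix (Fin n) (Fin n) ℂ}
    (hα : ∀ z ∈ Ω, (α z).PosDef) {T X c : ℝ} (hT : ∀ z ∈ Ω, (α z)⁻¹.trace.re ≤ T)
    (hX : ∀ z ∈ Ω, ((α z)⁻¹ * χ z).trace.re ≤ X)
    (hc : ∀ z ∈ Ω, ∀ ξ : Cn n, c * ‖ξ‖ ^ 2 ≤ (ξ.ofLp ⬝ᵥ ((α z)⁻¹ *ᵥ star ξ.ofLp)).re)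
    {q K r D : ℝ} (hc0 : 0 ≤ c) (hr : 0 ≤ r) (hq0 : 0 ≤ q) (hK0 : 0 ≤ K)
    (hq : T + 1 ≤ q * (c * r ^ 2)) (hK : X ≤ K * q * Real.exp (-q * D ^ 2))
    {y : Cn n} (hy : ∀ z ∈ closure Ω, r ≤ ‖z - y‖ ∧ ‖z - y‖ ≤ D)
    {u f : Cn n → ℝ} (hu : ContDiffOn ℝ 2 u (closure Ω))
    (hadm : IsAdmissibleSolutionOn m α χ (closure Ω) u f Ω) (hbd : ∀ z ∈ frontier Ω, u z = 0) :
    ∀ z ∈ closure Ω, u z ≤ barrier K q r y z := by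
  intro z hz
  obtain ⟨z₀, hz₀, hmax⟩ := hΩb.isCompact_closure.exists_isMaxOn ⟨z, hz⟩
    (hu.continuousOn.sub (continuous_barrier K q r y).continuousOn)
  have hle : u z - barrier K q r y z ≤ u z₀ - barrier K q r y z₀ := hmax hz
  by_cases h : z₀ ∈ Ω
  · exfalso
    have hs : closure Ω ∈ 𝓝 z₀ := mem_of_superset (hΩo.mem_nhds h) subset_closure
    have hu0 : ContDiffAt ℝ 2 u z₀ := hu.contDiffAt hs
    have hpsd := posSemidef_sub_cHessMat hs hu0 (hmax.isLocalMax hs)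
    have htr := (Complex.nonneg_iff.1 (trace_mul_nonneg (hα z₀ h) hpsd)).1
    obtain ⟨lam, hlam, hG, -⟩ := hadm z₀ h
    have h1 : 0 < esymm 1 lam := hG 1 le_rfl hm
    have h2 := congrArg Complex.re (hlam.esymm_one (hα z₀ h))
    rw [gMatOn_eq_add, Matrix.mul_add, trace_add, Complex.add_re, Complex.ofReal_re] at h2
    rw [Matrix.mul_sub, trace_sub, Complex.sub_re, re_trace_inv_mul_barrier] at htr
    have h3 := hX z₀ h
    have h4 := hT z₀ h
    have h5 := hc z₀ h (z₀ - y)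
    obtain ⟨h6, h7⟩ := hy z₀ hz₀
    have h8 : Real.exp (-q * D ^ 2) ≤ Real.exp (-q * ‖z₀ - y‖ ^ 2) := by
      apply Real.exp_le_exp.2
      nlinarith [mul_le_mul_of_nonneg_left (pow_le_pow_left₀ (norm_nonneg _) h7 2) hq0]
    have h9 : K * q * Real.exp (-q * D ^ 2) ≤ K * q * Real.exp (-q * ‖z₀ - y‖ ^ 2) :=
      mul_le_mul_of_nonneg_left h8 (mul_nonneg hK0 hq0)
    have h10 : q * (c * r ^ 2) ≤ q * (c * ‖z₀ - y‖ ^ 2) := by gcongr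
    have h11 := mul_le_mul_of_nonneg_left h5 hq0
    have h12 : 0 ≤ K * q * Real.exp (-q * ‖z₀ - y‖ ^ 2) := by positivity
    have h13 := mul_le_mul_of_nonneg_left (show (α z₀)⁻¹.trace.re -
      q * ((z₀ - y).ofLp ⬝ᵥ ((α z₀)⁻¹ *ᵥ star (z₀ - y).ofLp)).re ≤ -1 by linarith) h12
    linarith
  · have hf : z₀ ∈ frontier Ω := by
      rw [hΩo.frontier_eq]; exact ⟨hz₀, h⟩
    have h1 : 0 ≤ barrier K q r y z₀ := by
      refine mul_nonneg hK0 (sub_nonneg.2 (Real.exp_le_exp.2 ?_))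
      nlinarith [mul_le_mul_of_nonneg_left (pow_le_pow_left₀ hr (hy z₀ hz₀).1 2) hq0]
    rw [hbd z₀ hf] at hle
    linarith

lemma barrier_le_norm_sub {n : ℕ} {K q r D : ℝ} (hK0 : 0 ≤ K) (hq0 : 0 ≤ q) (hr : 0 ≤ r)
    {p y z : Cn n} (hp : ‖p - y‖ = r) (h1 : r ≤ ‖z - y‖) (h2 : ‖z - y‖ ≤ D) :
    barrier K q r y z ≤ 2 * K * q * D * ‖z - p‖ := by
  have e1 : Real.exp (-q * ‖z - y‖ ^ 2) =
      Real.exp (-q * r ^ 2) * Real.exp (-(q * (‖z - y‖ ^ 2 - r ^ 2))) := by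
    rw [← Real.exp_add]; ring_nf
  have e2 := Real.add_one_le_exp (-(q * (‖z - y‖ ^ 2 - r ^ 2)))
  have e3 : Real.exp (-q * r ^ 2) ≤ 1 := Real.exp_le_one_iff.2 (by nlinarith [sq_nonneg r])
  have e4 : ‖z - y‖ - r ≤ ‖z - p‖ := by
    have := norm_sub_norm_le (z - y) (p - y)
    rw [sub_sub_sub_cancel_right, hp] at this
    exact this
  have e5 : ‖z - y‖ ^ 2 - r ^ 2 ≤ 2 * D * ‖z - p‖ := by
    nlinarith [norm_nonneg (z - p), norm_nonneg (z - y)]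
  have e0 : 0 ≤ q * (‖z - y‖ ^ 2 - r ^ 2) :=
    mul_nonneg hq0 (sub_nonneg.2 (pow_le_pow_left₀ hr h1 2))
  have e6 : Real.exp (-q * r ^ 2) - Real.exp (-q * ‖z - y‖ ^ 2) ≤ q * (‖z - y‖ ^ 2 - r ^ 2) := by
    rw [e1]
    nlinarith [Real.exp_pos (-q * r ^ 2)]
  have e7 : Real.exp (-q * r ^ 2) - Real.exp (-q * ‖z - y‖ ^ 2) ≤ q * (2 * D * ‖z - p‖) :=
    e6.trans (mul_le_mul_of_nonneg_left e5 hq0)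
  calc barrier K q r y z ≤ K * (q * (2 * D * ‖z - p‖)) := mul_le_mul_of_nonneg_left e7 hK0
    _ = _ := by ring

/-- Solutions dominated by the subsolution `0` from below. -/
lemma nonneg_of_subsolution {n m : ℕ} (hm : 1 ≤ m) (hmn : m ≤ n) {Ω : Set (Cn n)}
    (hΩo : IsOpen Ω) (hΩb : Bornology.IsBounded Ω) {α χ : Cn n → Matrix (Fin n) (Fin n) ℂ}
    (hα : ∀ z ∈ Ω, (α z).PosDef) (hχ : ∀ z ∈ Ω, (χ z).PosDef) {u f : Cn n → ℝ}
    (hsub : ∀ z ∈ Ω, ∃ lam : Fin n → ℝ, IsEigenvalues (α z) (χ z) lam ∧ f z ≤ esymm m lam)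
    (hu : ContDiffOn ℝ 2 u (closure Ω))
    (hadm : IsAdmissibleSolutionOn m α χ (closure Ω) u f Ω) (hbd : ∀ z ∈ frontier Ω, u z = 0) :
    ∀ z ∈ closure Ω, 0 ≤ u z := by
  intro z hz
  obtain ⟨R, hR⟩ := hΩb.closure.exists_norm_le
  refine le_of_forall_pos_lt_add fun δ hδ => ?_
  obtain ⟨ε, hε, hεR⟩ : ∃ ε : ℝ, 0 < ε ∧ ε * R ^ 2 < δ :=
    ⟨δ / (R ^ 2 + 1), by positivity, by
      rw [div_mul_eq_mul_div, div_lt_iff₀ (by positivity)]; nlinarith [sq_nonneg R]⟩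
  have hbound : ∀ x ∈ closure Ω, ε * ‖x‖ ^ 2 ≤ ε * R ^ 2 := fun x hx =>
    mul_le_mul_of_nonneg_left (pow_le_pow_left₀ (norm_nonneg _) (hR x hx) 2) hε.le
  have hcont : Continuous fun x : Cn n => ε * ‖x‖ ^ 2 := by fun_prop
  obtain ⟨z₀, hz₀, hmin⟩ := hΩb.isCompact_closure.exists_isMinOn ⟨z, hz⟩
    (hu.continuousOn.sub hcont.continuousOn)
  have hle : u z₀ - ε * ‖z₀‖ ^ 2 ≤ u z - ε * ‖z‖ ^ 2 := hmin hz
  by_cases h : z₀ ∈ Ω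
  · exfalso
    have hs : closure Ω ∈ 𝓝 z₀ := mem_of_superset (hΩo.mem_nhds h) subset_closure
    have hu0 : ContDiffAt ℝ 2 u z₀ := hu.contDiffAt hs
    have hline : ∀ ξ : Cn n, 2 * ε * ‖ξ‖ ^ 2 ≤ fderiv ℝ (fderiv ℝ u) z₀ ξ ξ := by
      intro ξ
      refine snd_fderiv_ge_of_isLocalMin_sub hu0 (hmin.isLocalMin hs)
        (h' := fun t => 2 * (ε * (inner ℂ z₀ ξ).re) + 2 * (ε * ‖ξ‖ ^ 2) * t) (fun t => ?_) ?_
      · refine (hasDerivAt_quadratic (ε * ‖z₀‖ ^ 2) (ε * (inner ℂ z₀ ξ).re) (ε * ‖ξ‖ ^ 2)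
          t).congr_of_eventuallyEq (Eventually.of_forall fun t => ?_)
        simp only [norm_add_real_smul_sq]
        ring
      · have h1 := ((hasDerivAt_id (0 : ℝ)).const_mul (2 * (ε * ‖ξ‖ ^ 2))).const_add
          (2 * (ε * (inner ℂ z₀ ξ).re))
        refine h1.congr_deriv ?_
        ring
    have hpsd : (cHessMat (closure Ω) u z₀ -
        (ε : ℂ) • (1 : Matrix (Fin n) (Fin n) ℂ)).PosSemidef := by
      refine posSemidef_of_re_nonneg ?_ fun ξ => ?_
      · exact (cHessMat_isHermitian hs hu0).sub (isHermitian_one.ofReal_smul ε)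
      · rw [Matrix.sub_mulVec, dotProduct_sub, Complex.sub_re, re_form_cHessMat hs hu0,
          Matrix.smul_mulVec, Matrix.one_mulVec, dotProduct_smul, dotProduct_star_self,
          smul_eq_mul, Complex.re_ofReal_mul, Complex.ofReal_re]
        have h1 := hline ξ
        have h2 := hline (Complex.I • ξ)
        have h4 : ‖Complex.I • ξ‖ = ‖ξ‖ := by simp [norm_smul]
        rw [h4] at h2
        linarith
    have hpd : (cHessMat (closure Ω) u z₀).PosDef := by
      have h1 : ((ε : ℂ) • (1 : Matrix (Fin n) (Fin n) ℂ)).PosDef :=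
        PosDef.one.smul (by exact_mod_cast hε)
      simpa using h1.add_posSemidef hpsd
    obtain ⟨lam, hlam, hf⟩ := hsub z₀ h
    obtain ⟨mu, hmu, -, hmuf⟩ := hadm z₀ h
    rw [gMatOn_eq_add] at hmu
    have := IsEigenvalues.esymm_lt hm hmn (hα z₀ h) (hχ z₀ h) hpd hlam hmu
    linarith
  · have hf : z₀ ∈ frontier Ω := by
      rw [hΩo.frontier_eq]; exact ⟨hz₀, h⟩
    rw [hbd z₀ hf] at hle
    have := hbound z₀ hz₀
    have := mul_nonneg hε.le (sq_nonneg ‖z‖)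
    linarith

end Barrier

section Domain

open Matrix Topology Filter

/-- Second order Taylor estimate, uniform on balls. -/
lemma exists_taylor_bound {E : Type*} [NormedAddCommGroup E] [NormedSpace ℝ E] [ProperSpace E]
    {ρ : E → ℝ} (hρ : ContDiff ℝ 2 ρ) (R : ℝ) :
    ∃ M : ℝ, 0 < M ∧ ∀ p z : E, ‖p‖ ≤ R → ‖z‖ ≤ R →
      |ρ z - ρ p - fderiv ℝ ρ p (z - p)| ≤ M * ‖z - p‖ ^ 2 := by
  have h1 : ContDiff ℝ 1 (fderiv ℝ ρ) := hρ.fderiv_right le_rfl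
  have h2 : Continuous (fderiv ℝ (fderiv ℝ ρ)) := h1.continuous_fderiv one_ne_zero
  obtain ⟨M, hM⟩ := (isCompact_closedBall (0 : E) R).exists_bound_of_continuousOn
    (f := fderiv ℝ (fderiv ℝ ρ)) h2.continuousOn
  refine ⟨max M 1, by positivity, fun p z hp hz => ?_⟩
  have hp' : p ∈ closedBall (0 : E) R := by simpa using hp
  have hz' : z ∈ closedBall (0 : E) R := by simpa using hz
  have hseg : segment ℝ p z ⊆ closedBall (0 : E) R :=
    (convex_closedBall _ _).segment_subset hp' hz'
  have hlip : ∀ x ∈ segment ℝ p z, ‖fderiv ℝ ρ x - fderiv ℝ ρ p‖ ≤ max M 1 * ‖z - p‖ := by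
    intro x hx
    have h3 : ‖fderiv ℝ ρ x - fderiv ℝ ρ p‖ ≤ max M 1 * ‖x - p‖ :=
      (convex_closedBall (0 : E) R).norm_image_sub_le_of_norm_fderiv_le
        (fun w _ => (h1.differentiable one_ne_zero).differentiableAt)
        (fun w hw => (hM w hw).trans (le_max_left _ _)) hp' (hseg hx)
    refine h3.trans (mul_le_mul_of_nonneg_left ?_ (by positivity))
    have := norm_sub_le_of_mem_segment hx
    rwa [norm_sub_rev x, norm_sub_rev z, norm_sub_rev p, norm_sub_rev p] at *
  have := (convex_segment p z).norm_image_sub_le_of_norm_hasFDerivWithin_le' (f := ρ)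
    (fun x _ => ((hρ.differentiable two_ne_zero).differentiableAt.hasFDerivAt).hasFDerivWithinAt)
    hlip (left_mem_segment ℝ p z) (right_mem_segment ℝ p z)
  rw [Real.norm_eq_abs] at this
  exact this.trans_eq (by ring)

/-- A bounded smooth domain satisfies a uniform exterior ball condition. -/
lemma exists_exterior_ball {n : ℕ} {Ω : Set (Cn n)} (hΩb : Bornology.IsBounded Ω)
    {ρ : Cn n → ℝ} (hρ : ContDiff ℝ 2 ρ) (hΩρ : Ω = {z | ρ z < 0})
    (hfr : ∀ z ∈ frontier Ω, ρ z = 0 ∧ fderiv ℝ ρ z ≠ 0) :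
    ∃ r : ℝ, 0 < r ∧ ∀ p ∈ frontier Ω, ∃ y : Cn n, ‖p - y‖ = r ∧
      ∀ z ∈ closure Ω, r ≤ ‖z - y‖ := by
  obtain ⟨R, hR⟩ := hΩb.closure.exists_norm_le
  obtain ⟨M, hM0, hM⟩ := exists_taylor_bound hρ R
  obtain ⟨c, hc0, hc⟩ : ∃ c : ℝ, 0 < c ∧ ∀ p ∈ frontier Ω, c ≤ ‖fderiv ℝ ρ p‖ := by
    rcases (frontier Ω).eq_empty_or_nonempty with h | h
    · exact ⟨1, one_pos, by simp [h]⟩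
    · have hcomp : IsCompact (frontier Ω) :=
        hΩb.isCompact_closure.of_isClosed_subset isClosed_frontier frontier_subset_closure
      obtain ⟨p, hp, hmin⟩ := hcomp.exists_isMinOn h
        (hρ.continuous_fderiv two_ne_zero).norm.continuousOn
      exact ⟨_, norm_pos_iff.2 (hfr p hp).2, fun x hx => hmin hx⟩
  have hle0 : ∀ z ∈ closure Ω, ρ z ≤ 0 := by
    have : closure Ω ⊆ {z | ρ z ≤ 0} :=
      closure_minimal (by rw [hΩρ]; exact fun z (hz : ρ z < 0) => hz.le)
        (isClosed_le hρ.continuous continuous_const)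
    exact this
  refine ⟨c / (2 * M), by positivity, fun p hp => ?_⟩
  set r := c / (2 * M) with hr
  have hr0 : 0 < r := by positivity
  set g : Cn n := (InnerProductSpace.toDual ℝ (Cn n)).symm (fderiv ℝ ρ p) with hg
  have hgn : ‖g‖ = ‖fderiv ℝ ρ p‖ := by rw [hg, LinearIsometryEquiv.norm_map]
  have hgi : ∀ v, inner ℝ g v = fderiv ℝ ρ p v := fun v => by
    rw [hg, InnerProductSpace.toDual_symm_apply]
  have hgc : c ≤ ‖g‖ := hgn ▸ hc p hp
  have hg0 : 0 < ‖g‖ := hc0.trans_le hgc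
  have hnorm : ‖(r / ‖g‖) • g‖ = r := by
    rw [norm_smul, Real.norm_of_nonneg (by positivity)]
    field_simp
  refine ⟨p + (r / ‖g‖) • g, by simpa using hnorm, fun z hz => ?_⟩
  by_contra! hlt
  have e1 : ‖z - (p + (r / ‖g‖) • g)‖ ^ 2 =
      ‖z - p‖ ^ 2 - 2 * (r / ‖g‖) * fderiv ℝ ρ p (z - p) + r ^ 2 := by
    rw [← sub_sub, @norm_sub_sq_real, hnorm, inner_smul_right, real_inner_comm, hgi]
    ring
  have e2 : ‖z - (p + (r / ‖g‖) • g)‖ ^ 2 < r ^ 2 :=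
    pow_lt_pow_left₀ hlt (norm_nonneg _) two_ne_zero
  have e3 := hM p z (hR p (frontier_subset_closure hp)) (hR z hz)
  rw [(hfr p hp).1] at e3
  have e4 := (abs_le.1 e3).1
  have e5 := hle0 z hz
  set d := fderiv ℝ ρ p (z - p)
  have e6 : r / ‖g‖ * (2 * M) ≤ 1 := by
    rw [div_mul_eq_mul_div, div_le_one hg0, hr, div_mul_cancel₀ _ (by positivity)]
    exact hgc
  have e7 : 0 < r / ‖g‖ := by positivity
  have e8 : ‖z - p‖ ^ 2 < 2 * (r / ‖g‖) * d := by linarith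
  have e9 : 0 < d := by
    by_contra! hd
    nlinarith [sq_nonneg ‖z - p‖]
  nlinarith [mul_lt_mul_of_pos_left e8 hM0, mul_le_mul_of_nonneg_right e6 e9.le]

/-- A function squeezed between `0` and `C |z - p|` has gradient at most `C` at a smooth boundary
point `p`. -/
lemma norm_fderivWithin_le_of_squeeze {E : Type*} [NormedAddCommGroup E] [NormedSpace ℝ E]
    {Ω : Set E} {ρ : E → ℝ} {p : E} (hρ : DifferentiableAt ℝ ρ p) (hΩρ : Ω = {z | ρ z < 0})
    (hp0 : ρ p = 0) (hdp : fderiv ℝ ρ p ≠ 0) {u : E → ℝ} {C : ℝ} (hC : 0 ≤ C)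
    (hu : DifferentiableWithinAt ℝ u (closure Ω) p) (hup : u p = 0)
    (hsq : ∀ z ∈ closure Ω, 0 ≤ u z ∧ u z ≤ C * ‖z - p‖) :
    ‖fderivWithin ℝ u (closure Ω) p‖ ≤ C := by
  set L := fderivWithin ℝ u (closure Ω) p
  have hline : ∀ v : E, HasDerivAt (fun t : ℝ => p + t • v) v 0 := fun v => by
    simpa using ((hasDerivAt_id (0 : ℝ)).smul_const v).const_add p
  have hneg : ∀ v : E, fderiv ℝ ρ p v < 0 → |L v| ≤ C * ‖v‖ := by
    intro v hv
    have hρt : HasDerivAt (fun t : ℝ => ρ (p + t • v)) (fderiv ℝ ρ p v) 0 := by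
      have h := hρ.hasFDerivAt
      rw [show p = p + (0 : ℝ) • v by simp] at h
      simpa [Function.comp_def] using h.comp_hasDerivAt (0 : ℝ) (hline v)
    have hmem : ∀ᶠ t in 𝓝[>] (0 : ℝ), p + t • v ∈ closure Ω := by
      have h1 := hasDerivWithinAt_iff_tendsto_slope' Set.self_notMem_Ioi |>.1
        (hρt.hasDerivWithinAt (s := Set.Ioi 0))
      filter_upwards [h1.eventually (gt_mem_nhds hv), self_mem_nhdsWithin] with t ht ht0
      apply subset_closure
      rw [hΩρ]
      simp only [slope_def_field, zero_smul, add_zero, hp0, sub_zero] at ht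
      exact (div_neg_iff.1 ht).elim (fun h => absurd h.2 (not_lt.2 (le_of_lt ht0))) (fun h => h.1)
    have hder : HasDerivWithinAt (fun t : ℝ => u (p + t • v)) (L v) (Set.Ioi 0) 0 := by
      have h := hu.hasFDerivWithinAt
      have h2 : HasDerivWithinAt (fun t : ℝ => u (p + t • v)) (L v)
          {t | p + t • v ∈ closure Ω} 0 :=
        HasFDerivWithinAt.comp_hasDerivWithinAt_of_eq (t := closure Ω) (f := fun t : ℝ => p + t • v)
          0 h (hline v).hasDerivWithinAt (fun t ht => ht) (by simp)
      exact h2.mono_of_mem_nhdsWithin hmem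
    have hs := (hasDerivWithinAt_iff_tendsto_slope' Set.self_notMem_Ioi).1 hder
    have hb : ∀ᶠ t in 𝓝[>] (0 : ℝ), 0 ≤ slope (fun t : ℝ => u (p + t • v)) 0 t ∧
        slope (fun t : ℝ => u (p + t • v)) 0 t ≤ C * ‖v‖ := by
      filter_upwards [hmem, self_mem_nhdsWithin] with t ht ht0
      have ht0' : 0 < t := ht0
      obtain ⟨h1, h2⟩ := hsq _ ht
      rw [add_sub_cancel_left, norm_smul, Real.norm_of_nonneg ht0'.le] at h2
      simp only [slope_def_field, zero_smul, add_zero, hup, sub_zero]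
      refine ⟨by positivity, ?_⟩
      rw [div_le_iff₀ ht0']
      linarith
    have h1 : 0 ≤ L v := ge_of_tendsto hs (hb.mono fun _ h => h.1)
    have h2 : L v ≤ C * ‖v‖ := le_of_tendsto hs (hb.mono fun _ h => h.2)
    rwa [abs_of_nonneg h1]
  have hne : ∀ v : E, fderiv ℝ ρ p v ≠ 0 → |L v| ≤ C * ‖v‖ := by
    intro v hv
    rcases lt_or_gt_of_ne hv with h | h
    · exact hneg v h
    · simpa using hneg (-v) (by simpa using h)
  obtain ⟨e, he⟩ : ∃ e, fderiv ℝ ρ p e ≠ 0 := by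
    by_contra! h
    exact hdp (ContinuousLinearMap.ext h)
  refine L.opNorm_le_bound hC fun v => ?_
  by_cases hv : fderiv ℝ ρ p v = 0
  · have h1 : Tendsto (fun t : ℝ => |L (v + t • e)|) (𝓝[>] 0) (𝓝 |L v|) := by
      have : Continuous fun t : ℝ => |L (v + t • e)| := by fun_prop
      simpa using (this.tendsto 0).mono_left nhdsWithin_le_nhds
    have h2 : Tendsto (fun t : ℝ => C * ‖v + t • e‖) (𝓝[>] 0) (𝓝 (C * ‖v‖)) := by
      have : Continuous fun t : ℝ => C * ‖v + t • e‖ := by fun_prop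
      simpa using (this.tendsto 0).mono_left nhdsWithin_le_nhds
    refine le_of_tendsto_of_tendsto h1 h2 ?_
    filter_upwards [self_mem_nhdsWithin] with t ht
    refine hne _ ?_
    simp [hv, he, (ne_of_gt ht : t ≠ 0)]
  · exact hne v hv

lemma continuousOn_matrix_inv {X : Type*} [TopologicalSpace X] {n : ℕ}
    {α : X → Matrix (Fin n) (Fin n) ℂ} {S : Set X} (hα : ContinuousOn α S)
    (hpos : ∀ z ∈ S, (α z).PosDef) : ContinuousOn (fun z => (α z)⁻¹) S := by
  intro z hz
  refine (continuousAt_matrix_inv (α z) ?_).comp_continuousWithinAt (hα z hz)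
  have hdet : (α z).det ≠ 0 := (hpos z hz).det_pos.ne'
  rw [Ring.inverse_eq_inv']
  exact continuousAt_inv₀ hdet

/-- Uniform ellipticity on compact sets. -/
lemma exists_ellipticity {X : Type*} [TopologicalSpace X] {n : ℕ}
    {A : X → Matrix (Fin n) (Fin n) ℂ} {S : Set X} (hS : IsCompact S) (hA : ContinuousOn A S)
    (hpos : ∀ z ∈ S, (A z).PosDef) :
    ∃ c : ℝ, 0 < c ∧ ∀ z ∈ S, ∀ ξ : Cn n,
      c * ‖ξ‖ ^ 2 ≤ (ξ.ofLp ⬝ᵥ (A z *ᵥ star ξ.ofLp)).re := by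
  set F : X × Cn n → ℝ := fun q => (q.2.ofLp ⬝ᵥ (A q.1 *ᵥ star q.2.ofLp)).re with hF
  have hcont : ContinuousOn F (S ×ˢ sphere (0 : Cn n) 1) := by
    have h1 : ContinuousOn (fun q : X × Cn n => A q.1) (S ×ˢ sphere (0 : Cn n) 1) :=
      hA.comp continuousOn_fst fun q hq => hq.1
    have h2 : ∀ i j, ContinuousOn (fun q : X × Cn n => A q.1 i j) (S ×ˢ sphere (0 : Cn n) 1) :=
      fun i j => (continuous_apply_apply i j).comp_continuousOn h1
    simp only [hF, dotProduct, mulVec]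
    refine Complex.continuous_re.comp_continuousOn ?_
    refine continuousOn_finsetSum _ fun i _ => ContinuousOn.mul (by fun_prop) ?_
    refine continuousOn_finsetSum _ fun j _ => (h2 i j).mul ?_
    simp only [Pi.star_apply]
    fun_prop
  have hFpos : ∀ z ∈ S, ∀ ξ : Cn n, ξ ≠ 0 → 0 < F (z, ξ) := by
    intro z hz ξ hξ
    have := (hpos z hz).re_dotProduct_pos (x := star ξ.ofLp) (by simpa using hξ)
    simpa [hF] using this
  obtain ⟨c, hc0, hc⟩ : ∃ c : ℝ, 0 < c ∧ ∀ q ∈ S ×ˢ sphere (0 : Cn n) 1, c ≤ F q := by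
    rcases (S ×ˢ sphere (0 : Cn n) 1).eq_empty_or_nonempty with h | h
    · exact ⟨1, one_pos, by simp [h]⟩
    · obtain ⟨q, hq, hmin⟩ := (hS.prod (isCompact_sphere _ _)).exists_isMinOn h hcont
      refine ⟨F q, hFpos q.1 hq.1 q.2 ?_, fun x hx => hmin hx⟩
      exact ne_zero_of_mem_unit_sphere ⟨q.2, hq.2⟩
  refine ⟨c, hc0, fun z hz ξ => ?_⟩
  by_cases hξ : ξ = 0
  · simp [hξ]
  have hn : ‖ξ‖ ≠ 0 := norm_ne_zero_iff.2 hξ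
  set η : Cn n := ((‖ξ‖⁻¹ : ℝ) : ℂ) • ξ with hη
  have h1 := hc (z, η) ⟨hz, by simp [hη, norm_smul, hn]⟩
  have h2 : F (z, η) = (‖ξ‖ ^ 2)⁻¹ * F (z, ξ) := by
    simp only [hF, hη, WithLp.ofLp_smul, star_smul, mulVec_smul, dotProduct_smul, smul_dotProduct]
    rw [show star ((‖ξ‖⁻¹ : ℝ) : ℂ) = ((‖ξ‖⁻¹ : ℝ) : ℂ) from Complex.conj_ofReal _]
    rw [smul_smul, ← Complex.ofReal_mul, smul_eq_mul, Complex.re_ofReal_mul]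
    ring
  rw [h2, inv_mul_eq_div, le_div_iff₀ (by positivity)] at h1
  exact h1

end Domain

/-- Uniform bound and boundary gradient bound for admissible solutions,
given the subsolution condition `S_m(λ(B)) ≥ f` for `B = α⁻¹ χ`. -/
theorem stmt1 (n m : ℕ) (hn : 2 ≤ n) (hm : 1 ≤ m) (hmn : m ≤ n)
    (Ω : Set (Cn n)) (hΩ : IsSmoothDomain Ω)
    (α χ : Cn n → Matrix (Fin n) (Fin n) ℂ)
    (hα : IsHermitianMetricOn α (closure Ω))
    (hχ : IsRealFormOn χ (closure Ω))
    (hχα : ∀ z ∈ closure Ω, (χ z - α z).PosSemidef) :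
    ∃ C₀ C₀' : ℝ,
      ∀ f : Cn n → ℝ, ContinuousOn f (closure Ω) → (∀ z ∈ closure Ω, 0 < f z) →
        (∀ z ∈ closure Ω, ∃ lam : Fin n → ℝ,
          IsEigenvalues (α z) (χ z) lam ∧ f z ≤ esymm m lam) →
        ∀ u : Cn n → ℝ, ContDiffOn ℝ 2 u (closure Ω) →
          IsAdmissibleSolutionOn m α χ (closure Ω) u f Ω →
          (∀ z ∈ frontier Ω, u z = 0) →
          (∀ z ∈ closure Ω, 0 ≤ u z ∧ u z ≤ C₀) ∧
            ∀ z ∈ frontier Ω, ‖fderivWithin ℝ u (closure Ω) z‖ ≤ C₀' := by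
  obtain ⟨hΩo, hΩb, ρ, hρ, hΩρ, hfr⟩ := hΩ
  have hρ2 : ContDiff ℝ 2 ρ := mod_cast contDiff_infty.1 hρ 2
  have hcomp : IsCompact (closure Ω) := hΩb.isCompact_closure
  obtain ⟨r, hr0, hball⟩ := exists_exterior_ball hΩb hρ2 hΩρ hfr
  obtain ⟨R, hR⟩ := hΩb.closure.exists_norm_le
  have hαc : ContinuousOn α (closure Ω) :=
    continuousOn_pi.2 fun i => continuousOn_pi.2 fun j => (hα.1 i j).continuousOn
  have hχc : ContinuousOn χ (closure Ω) :=
    continuousOn_pi.2 fun i => continuousOn_pi.2 fun j => (hχ.1 i j).continuousOn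
  have hαi : ContinuousOn (fun z => (α z)⁻¹) (closure Ω) := continuousOn_matrix_inv hαc hα.2
  obtain ⟨c, hc0, hc⟩ := exists_ellipticity hcomp hαi fun z hz => (hα.2 z hz).inv
  have htrace : Continuous fun M : Matrix (Fin n) (Fin n) ℂ => M.trace.re :=
    Complex.continuous_re.comp continuous_id.matrix_trace
  obtain ⟨T, hT⟩ := hcomp.bddAbove_image (htrace.comp_continuousOn hαi)
  obtain ⟨X, hX⟩ := hcomp.bddAbove_image (htrace.comp_continuousOn (hαi.mul hχc))
  replace hT : ∀ z ∈ closure Ω, (α z)⁻¹.trace.re ≤ T := fun z hz => hT ⟨z, hz, rfl⟩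
  replace hX : ∀ z ∈ closure Ω, ((α z)⁻¹ * χ z).trace.re ≤ X := fun z hz => hX ⟨z, hz, rfl⟩
  set D : ℝ := 2 * R + r with hD
  obtain ⟨q, hq0, hq⟩ : ∃ q : ℝ, 0 < q ∧ T + 1 ≤ q * (c * r ^ 2) := by
    refine ⟨max ((T + 1) / (c * r ^ 2)) 1, by positivity, ?_⟩
    rw [← div_le_iff₀ (by positivity)]
    exact le_max_left _ _
  obtain ⟨K, hK0, hK⟩ : ∃ K : ℝ, 0 < K ∧ X ≤ K * q * Real.exp (-q * D ^ 2) := by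
    refine ⟨max (X / (q * Real.exp (-q * D ^ 2))) 1, by positivity, ?_⟩
    rw [mul_assoc, ← div_le_iff₀ (by positivity)]
    exact le_max_left _ _
  refine ⟨K, 2 * K * q * D, fun f _ _ hsub u hu hadm hbd => ?_⟩
  have hα' : ∀ z ∈ Ω, (α z).PosDef := fun z hz => hα.2 z (subset_closure hz)
  have hχ' : ∀ z ∈ Ω, (χ z).PosDef := fun z hz => by
    simpa using (hα' z hz).add_posSemidef (hχα z (subset_closure hz))
  have hnonneg := nonneg_of_subsolution hm hmn hΩo hΩb hα' hχ'
    (fun z hz => hsub z (subset_closure hz)) hu hadm hbd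
  have hupper : ∀ p ∈ frontier Ω, ∃ y : Cn n, ‖p - y‖ = r ∧ (∀ z ∈ closure Ω,
      (r ≤ ‖z - y‖ ∧ ‖z - y‖ ≤ D) ∧ u z ≤ barrier K q r y z) := by
    intro p hp
    obtain ⟨y, hpy, hy⟩ := hball p hp
    have hy' : ∀ z ∈ closure Ω, r ≤ ‖z - y‖ ∧ ‖z - y‖ ≤ D := fun z hz => by
      refine ⟨hy z hz, ?_⟩
      have h1 := norm_sub_le_norm_sub_add_norm_sub z p y
      have h2 := norm_sub_le z p
      have h3 := hR z hz
      have h4 := hR p (frontier_subset_closure hp)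
      linarith
    exact ⟨y, hpy, fun z hz => ⟨hy' z hz, le_barrier hm hΩo hΩb hα'
      (fun z hz => hT z (subset_closure hz)) (fun z hz => hX z (subset_closure hz))
      (fun z hz => hc z (subset_closure hz)) hc0.le hr0.le hq0.le hK0.le hq hK hy' hu hadm hbd
      z hz⟩⟩
  constructor
  · intro z hz
    refine ⟨hnonneg z hz, ?_⟩
    obtain ⟨p, hp⟩ : (frontier Ω).Nonempty := by
      have : Nonempty (Fin n) := ⟨⟨0, by omega⟩⟩
      refine nonempty_frontier_iff.2 ⟨closure_nonempty_iff.1 ⟨z, hz⟩, ?_⟩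
      rintro rfl
      exact NormedSpace.unbounded_univ ℝ (Cn n) hΩb
    obtain ⟨y, -, hy⟩ := hupper p hp
    refine (hy z hz).2.trans ?_
    have h1 : Real.exp (-q * r ^ 2) ≤ 1 := Real.exp_le_one_iff.2 (by nlinarith [sq_nonneg r])
    have h2 := Real.exp_pos (-q * ‖z - y‖ ^ 2)
    calc barrier K q r y z ≤ K * 1 := mul_le_mul_of_nonneg_left (by linarith) hK0.le
      _ = K := mul_one K
  · intro p hp
    obtain ⟨y, hpy, hy⟩ := hupper p hp
    have hpc := frontier_subset_closure hp
    have hD0 : 0 ≤ D := hr0.le.trans ((hy p hpc).1.1.trans (hy p hpc).1.2)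
    exact norm_fderivWithin_le_of_squeeze (hρ2.differentiable two_ne_zero).differentiableAt hΩρ
      (hfr p hp).1 (hfr p hp).2 (by positivity)
      ((hu p hpc).differentiableWithinAt two_ne_zero) (hbd p hp)
      fun z hz => ⟨hnonneg z hz, (hy z hz).2.trans (barrier_le_norm_sub hK0.le hq0.le hr0.le hpy
        (hy z hz).1.1 (hy z hz).1.2)⟩
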